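/- Assume the transshipment problem is feasible. Under the Physarum dynamics, there exist constants C > 0 and a > 0 such that |Ψ(p(t))_e − 1| ≤ C·e^{−at} for all t ≥ 0 and every arc e ∈ Ĥ, where Ĥ is the set of arcs carried by some minimum-cost positive flow. -/

import Mathlib

open scoped BigOperators

section PhysarumSetup

variable {V E : Type*} [Fintype V] [Fintype E] [DecidableEq V] [DecidableEq E]

/-- Incidence (boundary) matrix of the digraph given by `tail`/`head`:
`+1` if `i` is the tail of `e`, `-1` if `i` is the head of `e`, `0` otherwise. -/
def incMatrix (tail head : E → V) : Matrix V E ℝ :=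
  Matrix.of fun i e => if tail e = i then (1 : ℝ) else if head e = i then -1 else 0

/-- The digraph has no loops. -/
def NoLoops (tail head : E → V) : Prop := ∀ e, tail e ≠ head e

/-- The digraph has no multiple arcs. -/
def NoMultiple (tail head : E → V) : Prop :=
  ∀ e f, tail e = tail f → head e = head f → e = f

/-- Adjacency in the underlying undirected graph. -/
def Adj (tail head : E → V) (i j : V) : Prop :=
  ∃ e, (tail e = i ∧ head e = j) ∨ (tail e = j ∧ head e = i)

/-- The underlying undirected graph is connected. -/
def IsConnectedGraph (tail head : E → V) : Prop :=
  ∀ i j : V, Relation.ReflTransGen (Adj tail head) i j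

/-- `φ` is a flow with source vector `b`: `Bφ = b`. -/
def IsFlow (tail head : E → V) (b : V → ℝ) (φ : E → ℝ) : Prop :=
  (incMatrix tail head).mulVec φ = b

/-- Net supply `b(S)` of a vertex set `S`. -/
def netSupply (b : V → ℝ) (S : Finset V) : ℝ := ∑ i ∈ S, b i

/-- `b*_max = max_{S ⊆ V} |b(S)|`. -/
noncomputable def bstarMax (b : V → ℝ) : ℝ :=
  sSup {x | ∃ S : Finset V, x = |netSupply b S|}

/-- `b*_min = min { |b(S)| : S ⊆ V, b(S) ≠ 0 }`. -/
noncomputable def bstarMin (b : V → ℝ) : ℝ :=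
  sInf {x | ∃ S : Finset V, netSupply b S ≠ 0 ∧ x = |netSupply b S|}

/-- The support of an arc vector. -/
def suppE (φ : E → ℝ) : Set E := {e | φ e ≠ 0}

/-- An arc set is a forest in the underlying undirected graph:
equivalently, it supports no nonzero circulation. -/
def ForestSupport (tail head : E → V) (s : Set E) : Prop :=
  ∀ γ : E → ℝ, (incMatrix tail head).mulVec γ = 0 → (∀ e, γ e ≠ 0 → e ∈ s) → γ = 0

/-- A basic feasible solution: a positive flow whose support is a forest
in the underlying undirected graph. -/
def IsBFS (tail head : E → V) (b : V → ℝ) (f : E → ℝ) : Prop :=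
  IsFlow tail head b f ∧ (∀ e, 0 ≤ f e) ∧ ForestSupport tail head (suppE f)

/-- A vector is circulation free if its support contains no directed cycle:
equivalently, it supports no nonzero nonnegative circulation. -/
def CirculationFree (tail head : E → V) (φ : E → ℝ) : Prop :=
  ∀ γ : E → ℝ, (incMatrix tail head).mulVec γ = 0 → (∀ e, 0 ≤ γ e) →
    (∀ e, γ e ≠ 0 → φ e ≠ 0) → γ = 0

/-- The weighted graph Laplacian `L(σ) = B · diag(σ/ℓ) · Bᵀ`. -/
noncomputable def lap (tail head : E → V) (ℓ σ : E → ℝ) : Matrix V V ℝ :=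
  incMatrix tail head * Matrix.diagonal (fun e => σ e / ℓ e) * (incMatrix tail head).transpose

/-- The field (slope) of a potential: `Ψ(p)_{ij} = (p_i - p_j)/ℓ_{ij}`. -/
noncomputable def field (tail head : E → V) (ℓ : E → ℝ) (p : V → ℝ) : E → ℝ :=
  fun e => (p (tail e) - p (head e)) / ℓ e

/-- The set of vertices incident to an arc set `H`. -/
def VSet (tail head : E → V) (H : Set E) : Set V :=
  {i | ∃ e ∈ H, tail e = i ∨ head e = i}

/-- Undirected reachability using only arcs in `H`. -/
def UReach (tail head : E → V) (H : Set E) : V → V → Prop :=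
  Relation.ReflTransGen
    (fun i j => ∃ e ∈ H, (tail e = i ∧ head e = j) ∨ (tail e = j ∧ head e = i))

/-- `WalkLen tail head ℓ H i j L`: there is a walk in the underlying undirected
graph of `H` from `i` to `j` of total `ℓ`-length `L`. -/
inductive WalkLen (tail head : E → V) (ℓ : E → ℝ) (H : Set E) : V → V → ℝ → Prop
  | refl (i : V) : WalkLen tail head ℓ H i i 0
  | step {j k : V} {L : ℝ} (i : V) (e : E) (he : e ∈ H)
      (hik : (tail e = i ∧ head e = j) ∨ (tail e = j ∧ head e = i))
      (hw : WalkLen tail head ℓ H j k L) : WalkLen tail head ℓ H i k (ℓ e + L)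

/-- The minimal `ℓ`-length of a connecting walk within `H`. -/
noncomputable def wdist (tail head : E → V) (ℓ : E → ℝ) (H : Set E) (i j : V) : ℝ :=
  sInf {L | WalkLen tail head ℓ H i j L}

/-- The `ℓ`-diameter of `H`: the maximum of `wdist` over pairs of vertices lying in
a common component of `H`. -/
noncomputable def wdiam (tail head : E → V) (ℓ : E → ℝ) (H : Set E) : ℝ :=
  sSup {x | ∃ i j : V, (∃ L, WalkLen tail head ℓ H i j L) ∧ x = wdist tail head ℓ H i j}

/-- Maximum norm of `p` restricted to a vertex set `A`. -/
noncomputable def supNormOn (A : Set V) (p : V → ℝ) : ℝ := sSup {x | ∃ i ∈ A, x = |p i|}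

/-- Maximum norm of an arc vector. -/
noncomputable def eSupNorm (x : E → ℝ) : ℝ := sSup {r | ∃ e : E, r = |x e|}

/-- `min { σ_e : σ_e > 0 }`. -/
noncomputable def minPos (σ : E → ℝ) : ℝ := sInf {x | ∃ e, 0 < σ e ∧ x = σ e}

/-- `min_e ℓ_e`. -/
noncomputable def minLen (ℓ : E → ℝ) : ℝ := sInf {x | ∃ e : E, x = ℓ e}

/-- The cost `ℓᵀφ` of a flow. -/
def cost (ℓ φ : E → ℝ) : ℝ := ∑ e, ℓ e * φ e

/-- The transshipment problem is feasible: there is a positive flow. -/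
def Feasible (tail head : E → V) (b : V → ℝ) : Prop :=
  ∃ φ : E → ℝ, IsFlow tail head b φ ∧ ∀ e, 0 ≤ φ e

/-- `φ` is a minimum-cost positive flow. -/
def IsOptimal (tail head : E → V) (ℓ : E → ℝ) (b : V → ℝ) (φ : E → ℝ) : Prop :=
  IsFlow tail head b φ ∧ (∀ e, 0 ≤ φ e) ∧
    ∀ ψ : E → ℝ, IsFlow tail head b ψ → (∀ e, 0 ≤ ψ e) → cost ℓ φ ≤ cost ℓ ψ

/-- `Ĥ`: the set of arcs carried by some minimum-cost positive flow. -/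
def optSupport (tail head : E → V) (ℓ : E → ℝ) (b : V → ℝ) : Set E :=
  {e | ∃ φ : E → ℝ, IsOptimal tail head ℓ b φ ∧ 0 < φ e}

/-- The current `φ(t) = σ(t)·Ψ(p(t))` of the Physarum solver. -/
noncomputable def current (tail head : E → V) (ℓ : E → ℝ) (σ : ℝ → E → ℝ)
    (p : ℝ → V → ℝ) (t : ℝ) : E → ℝ :=
  fun e => σ t e * field tail head ℓ (p t) e

/-- The Physarum dynamics: `σ(t) > 0` and continuously differentiable on `[0,∞)`,
`L(σ(t)) p(t) = b`, and `σ' = φ - σ` where `φ(t) = σ(t)·Ψ(p(t))`. -/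
structure PhysarumDynamics (tail head : E → V) (ℓ : E → ℝ) (b : V → ℝ)
    (σ : ℝ → E → ℝ) (p : ℝ → V → ℝ) : Prop where
  pos : ∀ t : ℝ, 0 ≤ t → ∀ e, 0 < σ t e
  kirchhoff : ∀ t : ℝ, 0 ≤ t → (lap tail head ℓ (σ t)).mulVec (p t) = b
  contp : ContinuousOn (fun t => p t) (Set.Ici (0 : ℝ))
  dyn : ∀ t ∈ Set.Ici (0 : ℝ), ∀ e : E,
    HasDerivWithinAt (fun s => σ s e)
      (current tail head ℓ σ p t e - σ t e) (Set.Ici (0 : ℝ)) t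

/-- A directed walk from `i` to `j` using the listed arcs in order. -/
inductive DiWalk (tail head : E → V) : V → V → List E → Prop
  | nil (i : V) : DiWalk tail head i i []
  | cons {j k : V} {es : List E} (i : V) (e : E) (h1 : tail e = i) (h2 : head e = j)
      (hw : DiWalk tail head j k es) : DiWalk tail head i k (e :: es)

/-- Discrete `∞`-harmonicity of `p` at node `i` with respect to the arc set `H`:
the maximal in-slope equals the maximal out-slope, and both are nonnegative. -/
noncomputable def InfHarmAt (tail head : E → V) (ℓ : E → ℝ) (H : Set E)
    (p : V → ℝ) (i : V) : Prop :=
  sSup {r | ∃ e ∈ H, head e = i ∧ r = (p (tail e) - p i) / ℓ e}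
    = sSup {r | ∃ e ∈ H, tail e = i ∧ r = (p i - p (head e)) / ℓ e}
  ∧ 0 ≤ sSup {r | ∃ e ∈ H, tail e = i ∧ r = (p i - p (head e)) / ℓ e}

end PhysarumSetup

theorem exists_pos_orthogonal_of_no_nonneg {ι : Type*} [Fintype ι] [DecidableEq ι]
    (W : Submodule ℝ (ι → ℝ)) (hW : ∀ w ∈ W, 0 ≤ w → w = 0) :
    ∃ y : ι → ℝ, (∀ i, 0 < y i) ∧ ∀ w ∈ W, ∑ i, y i * w i = 0 := by
  have hdisj : Disjoint (stdSimplex ℝ ι) (W : Set (ι → ℝ)) := by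
    rw [Set.disjoint_left]
    intro w hw hwW
    have h0 := hW w hwW hw.1
    have h1 := hw.2
    simp [h0] at h1
  obtain ⟨f, u, v, hu, huv, hv⟩ := geometric_hahn_banach_compact_closed
    (convex_stdSimplex ℝ ι) (isCompact_stdSimplex ℝ ι) W.convex W.closed_of_finiteDimensional hdisj
  have hv0 : v < 0 := by simpa using hv 0 W.zero_mem
  have hf : ∀ x : ι → ℝ, f x = ∑ i, f (Pi.single i 1) * x i := by
    intro x
    have := LinearMap.pi_apply_eq_sum_univ f.toLinearMap x
    simp only [ContinuousLinearMap.coe_coe, smul_eq_mul] at this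
    rw [this]
    refine Finset.sum_congr rfl fun i _ => ?_
    rw [mul_comm]
    congr 2
    ext j
    simp [Pi.single_apply, eq_comm]
  refine ⟨fun i => -f (Pi.single i 1), fun i => ?_, fun w hw => ?_⟩
  · have := hu _ (single_mem_stdSimplex ℝ i)
    linarith
  · have hfw : f w = 0 := by
      by_contra hne
      have h1 := hv ((v / f w) • w) (W.smul_mem _ hw)
      rw [map_smul, smul_eq_mul, div_mul_cancel₀ _ hne] at h1
      exact lt_irrefl _ h1
    rw [hf] at hfw
    simp [hfw]

theorem exists_pos_forall_mul_le {ι : Type*} [Finite ι] {w y : ι → ℝ} (hw : ∀ i, 0 ≤ w i)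
    (hy : ∀ i, w i = 0 → y i ≤ 0) : ∃ t > (0 : ℝ), ∀ i, t * y i ≤ w i := by
  have h : ∀ᶠ t in nhdsWithin (0 : ℝ) (Set.Ioi 0), ∀ i, t * y i ≤ w i := by
    rw [Filter.eventually_all]
    intro i
    rcases (hw i).eq_or_lt with h0 | h0
    · filter_upwards [self_mem_nhdsWithin] with t ht
      rw [← h0]
      exact mul_nonpos_of_nonneg_of_nonpos (le_of_lt ht) (hy i h0.symm)
    · have hc : Filter.Tendsto (fun t : ℝ => t * y i) (nhdsWithin 0 (Set.Ioi 0)) (nhds (0 * y i)) :=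
        ((continuous_id.mul continuous_const).tendsto 0).mono_left nhdsWithin_le_nhds
      rw [zero_mul] at hc
      filter_upwards [hc.eventually (gt_mem_nhds h0)] with t ht using ht.le
  obtain ⟨t, ht, ht0⟩ := (h.and self_mem_nhdsWithin).exists
  exact ⟨t, ht0, ht⟩

/-- On the nonnegative vectors supported in `s`, either `A` has a nontrivial zero or it is
bounded below. -/
theorem exists_nonneg_ker_or_bound {ι κ : Type*} [Fintype ι] [Fintype κ]
    (A : (ι → ℝ) →ₗ[ℝ] (κ → ℝ)) (s : Set ι) :
    (∃ y : ι → ℝ, 0 ≤ y ∧ y ≠ 0 ∧ (∀ i, i ∉ s → y i = 0) ∧ A y = 0) ∨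
      ∃ C : ℝ, 0 ≤ C ∧ ∀ w : ι → ℝ, 0 ≤ w → (∀ i, i ∉ s → w i = 0) → ∀ i, w i ≤ C * ‖A w‖ := by
  by_cases hz : ∃ y : ι → ℝ, 0 ≤ y ∧ y ≠ 0 ∧ (∀ i, i ∉ s → y i = 0) ∧ A y = 0
  · exact Or.inl hz
  right
  have hcl : IsClosed {w : ι → ℝ | ∀ i, i ∉ s → w i = 0} := by
    simp only [Set.ofPred_forall]
    exact isClosed_iInter fun i => isClosed_iInter fun _ =>
      isClosed_eq (continuous_apply i) continuous_const
  have hcont : Continuous fun w => ‖A w‖ := A.continuous_of_finiteDimensional.norm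
  obtain ⟨m, hm, hmin⟩ := ((isCompact_stdSimplex ℝ ι).inter_right hcl).exists_forall_le'
    hcont.continuousOn (a := 0) (by
      rintro w ⟨hw, hws⟩
      rw [norm_pos_iff]
      intro h0
      refine hz ⟨w, hw.1, ?_, hws, h0⟩
      rintro rfl
      simpa using hw.2)
  refine ⟨m⁻¹, by positivity, fun w hw hws i => ?_⟩
  have hle : w i ≤ ∑ j, w j := Finset.single_le_sum (fun j _ => hw j) (Finset.mem_univ i)
  rcases (Finset.sum_nonneg fun j (_ : j ∈ Finset.univ) => hw j).eq_or_lt with h0 | h0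
  · have : 0 ≤ m⁻¹ * ‖A w‖ := by positivity
    linarith
  · have h1 := hmin ((∑ j, w j)⁻¹ • w) ⟨⟨fun j => by
      have := hw j
      simp only [Pi.smul_apply, smul_eq_mul, Pi.zero_apply] at *
      positivity, by
      simp only [Pi.smul_apply, smul_eq_mul]
      rw [← Finset.mul_sum, inv_mul_cancel₀ h0.ne']⟩, fun j hj => by simp [hws j hj]⟩
    rw [map_smul, norm_smul, Real.norm_of_nonneg (inv_nonneg.2 h0.le)] at h1
    have h2 : m * ∑ j, w j ≤ ‖A w‖ := by
      have := mul_le_mul_of_nonneg_right h1 h0.le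
      rwa [mul_right_comm, inv_mul_cancel₀ h0.ne', one_mul] at this
    calc w i ≤ ∑ j, w j := hle
      _ = m⁻¹ * (m * ∑ j, w j) := by rw [inv_mul_cancel_left₀ hm.ne']
      _ ≤ _ := by gcongr

/-- A nonnegative vector dominates a nonnegative kernel vector of `A` up to an error
controlled by the residual. -/
theorem exists_conformal_ker {ι κ : Type*} [Fintype ι] [Fintype κ]
    (A : (ι → ℝ) →ₗ[ℝ] (κ → ℝ)) :
    ∃ C : ℝ, 0 ≤ C ∧ ∀ x : ι → ℝ, 0 ≤ x →
      ∃ z : ι → ℝ, 0 ≤ z ∧ z ≤ x ∧ A z = 0 ∧ ∀ i, x i - z i ≤ C * ‖A x‖ := by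
  classical
  have hs : ∀ s : Set ι, ∃ C : ℝ, 0 ≤ C ∧
      ((∃ y : ι → ℝ, 0 ≤ y ∧ y ≠ 0 ∧ (∀ i, i ∉ s → y i = 0) ∧ A y = 0) ∨
      ∀ w : ι → ℝ, 0 ≤ w → (∀ i, i ∉ s → w i = 0) → ∀ i, w i ≤ C * ‖A w‖) := by
    intro s
    rcases exists_nonneg_ker_or_bound A s with h | ⟨C, hC, h⟩
    · exact ⟨0, le_rfl, Or.inl h⟩
    · exact ⟨C, hC, Or.inr h⟩
  choose C hC hCs using hs
  refine ⟨∑ s, C s, Finset.sum_nonneg fun s _ => hC s, fun x hx => ?_⟩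
  have hcl : IsClosed {z : ι → ℝ | A z = 0} :=
    isClosed_eq A.continuous_of_finiteDimensional continuous_const
  obtain ⟨z, ⟨hz, hAz⟩, hmax⟩ := ((isCompact_Icc (a := (0 : ι → ℝ)) (b := x)).inter_right
    hcl).exists_isMaxOn ⟨0, ⟨le_rfl, hx⟩, map_zero A⟩
    (f := fun z => ∑ i, z i) (by fun_prop)
  refine ⟨z, hz.1, hz.2, hAz, ?_⟩
  have hw0 : 0 ≤ x - z := sub_nonneg.2 hz.2
  have hAw : A (x - z) = A x := by
    rw [map_sub, show A z = 0 from hAz, sub_zero]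
  rcases hCs {i | (x - z) i ≠ 0} with ⟨y, hy0, hyne, hys, hAy⟩ | hb
  · exfalso
    obtain ⟨t, ht, hty⟩ := exists_pos_forall_mul_le (w := x - z) (y := y) hw0
      (fun i hi => (hys i (by simpa using hi)).le)
    have hmem : z + t • y ∈ Set.Icc 0 x ∩ {z : ι → ℝ | A z = 0} := by
      refine ⟨⟨?_, fun i => ?_⟩, ?_⟩
      · exact add_nonneg hz.1 (smul_nonneg ht.le hy0)
      · have := hty i
        simp only [Pi.sub_apply, Pi.add_apply, Pi.smul_apply, smul_eq_mul] at *
        linarith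
      · simp [hAy, show A z = 0 from hAz]
    have h1 : ∑ i, (z + t • y) i ≤ ∑ i, z i := hmax hmem
    simp only [Pi.add_apply, Pi.smul_apply, smul_eq_mul, Finset.sum_add_distrib,
      ← Finset.mul_sum] at h1
    have h2 : ∑ i, y i ≤ 0 := by
      by_contra h
      push Not at h
      nlinarith [mul_pos ht h]
    apply hyne
    have h3 : ∑ i, y i = 0 := le_antisymm h2 (Finset.sum_nonneg fun i _ => hy0 i)
    rw [Finset.sum_eq_zero_iff_of_nonneg fun i _ => hy0 i] at h3
    ext i
    exact h3 i (Finset.mem_univ i)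
  · intro i
    have h1 := hb (x - z) hw0 (fun i hi => by simpa using hi) i
    rw [hAw] at h1
    refine h1.trans ?_
    gcongr
    exact Finset.single_le_sum (f := C) (fun s _ => hC s) (Finset.mem_univ _)

theorem exists_bounded_preimage {X F : Type*} [NormedAddCommGroup X] [NormedSpace ℝ X]
    [FiniteDimensional ℝ X] [NormedAddCommGroup F] [NormedSpace ℝ F] [FiniteDimensional ℝ F]
    (A : X →ₗ[ℝ] F) : ∃ C : ℝ, 0 ≤ C ∧ ∀ x, ∃ x', A x' = A x ∧ ‖x'‖ ≤ C * ‖A x‖ := by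
  obtain ⟨g, hg⟩ := A.rangeRestrict.exists_rightInverse_of_surjective A.range_rangeRestrict
  refine ⟨‖LinearMap.toContinuousLinearMap g‖, ContinuousLinearMap.opNorm_nonneg _, fun x =>
    ⟨g (A.rangeRestrict x), ?_, ?_⟩⟩
  · have := congrArg Subtype.val (LinearMap.congr_fun hg (A.rangeRestrict x))
    simpa using this
  · exact (LinearMap.toContinuousLinearMap g).le_opNorm (A.rangeRestrict x)

theorem exists_pos_forall_le {ι : Type*} [Finite ι] {P : ι → Prop} {f : ι → ℝ}
    (hf : ∀ i, P i → 0 < f i) : ∃ ρ > (0 : ℝ), ∀ i, P i → ρ ≤ f i := by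
  classical
  have hw : ∀ i, 0 < if P i then f i else 1 := fun i => by
    split_ifs with h
    · exact hf i h
    · exact one_pos
  obtain ⟨t, ht, h⟩ := exists_pos_forall_mul_le (fun i => (hw i).le) (y := fun _ => 1)
    fun i hi => absurd hi (hw i).ne'
  exact ⟨t, ht, fun i hi => by simpa [hi] using h i⟩

theorem abs_sum_mul_le {ι : Type*} [Fintype ι] (q x : ι → ℝ) : |∑ i, q i * x i| ≤ (∑ i, |q i|) * ‖x‖ := by
  rw [Finset.sum_mul]
  refine (Finset.abs_sum_le_sum_abs _ _).trans (Finset.sum_le_sum fun i _ => ?_)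
  rw [abs_mul]
  exact mul_le_mul_of_nonneg_left (norm_le_pi_norm x i) (abs_nonneg _)

section Network

variable {V E : Type*} [DecidableEq V] {tail head : E → V}

theorem incMatrix_transpose_mulVec [Fintype V] (hloops : NoLoops tail head) (q : V → ℝ) (e : E) :
    (incMatrix tail head).transpose.mulVec q e = q (tail e) - q (head e) := by
  have h : ∀ i, (if tail e = i then (1 : ℝ) else if head e = i then -1 else 0) * q i
      = (if tail e = i then q i else 0) - (if head e = i then q i else 0) := by
    intro i
    by_cases h1 : tail e = i
    · have h2 : head e ≠ i := fun h2 => hloops e (h1.trans h2.symm)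
      simp [h1, h2]
    · by_cases h2 : head e = i <;> simp [h1, h2]
  simp only [Matrix.mulVec, dotProduct, Matrix.transpose_apply, incMatrix, Matrix.of_apply, h,
    Finset.sum_sub_distrib, Finset.sum_ite_eq, Finset.mem_univ, if_true]

theorem sum_mul_potential_sub [Fintype V] [Fintype E] (hloops : NoLoops tail head) (q : V → ℝ) (x : E → ℝ) :
    ∑ e, x e * (q (tail e) - q (head e)) = ∑ i, q i * (incMatrix tail head).mulVec x i := by
  have h := Matrix.dotProduct_mulVec q (incMatrix tail head) x
  rw [← Matrix.mulVec_transpose] at h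
  simp only [dotProduct, incMatrix_transpose_mulVec hloops] at h
  rw [h]
  exact Finset.sum_congr rfl fun e _ => mul_comm _ _

theorem isFlow_of_lap_mulVec [Fintype V] [Fintype E] [DecidableEq E] (hloops : NoLoops tail head) {ℓ s : E → ℝ}
    {b p : V → ℝ} (h : (lap tail head ℓ s).mulVec p = b) :
    IsFlow tail head b fun e => s e * field tail head ℓ p e := by
  rw [← h, IsFlow, lap, ← Matrix.mulVec_mulVec, ← Matrix.mulVec_mulVec]
  congr 1
  ext e
  rw [Matrix.mulVec_diagonal, incMatrix_transpose_mulVec hloops, field]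
  ring

theorem exists_potential_of_orthogonal_ker [Fintype V] [Fintype E] [DecidableEq E] (hloops : NoLoops tail head)
    (c : E → ℝ)
    (hc : ∀ γ : E → ℝ, (incMatrix tail head).mulVec γ = 0 → ∑ e, c e * γ e = 0) :
    ∃ q : V → ℝ, ∀ e, c e = q (tail e) - q (head e) := by
  let f : Module.Dual ℝ (E → ℝ) := ∑ e, c e • LinearMap.proj e
  have hf : ∀ x, f x = ∑ e, c e * x e := fun x => by simp [f]
  have hmem : f ∈ (LinearMap.ker (incMatrix tail head).mulVecLin).dualAnnihilator := by
    rw [Submodule.mem_dualAnnihilator]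
    intro γ hγ
    rw [hf]
    exact hc γ hγ
  rw [← LinearMap.range_dualMap_eq_dualAnnihilator_ker] at hmem
  obtain ⟨g, hg⟩ := hmem
  refine ⟨fun i => g fun j => if i = j then 1 else 0, fun e => ?_⟩
  have h1 := hf (Pi.single e 1)
  rw [← hg, LinearMap.dualMap_apply, LinearMap.pi_apply_eq_sum_univ] at h1
  have h2 := sum_mul_potential_sub hloops (fun i => g fun j => if i = j then 1 else 0)
    (Pi.single e 1)
  simp only [Matrix.mulVecLin_apply, smul_eq_mul, Pi.single_apply, mul_ite, mul_one, mul_zero,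
    Finset.sum_ite_eq', Finset.mem_univ, if_true, ite_mul, one_mul, zero_mul] at h1 h2
  rw [← h1, h2]
  exact Finset.sum_congr rfl fun i _ => mul_comm _ _

theorem exists_isOptimal [Fintype E] {ℓ : E → ℝ} (hℓ : ∀ e, 0 < ℓ e) {b : V → ℝ}
    (hfeas : Feasible tail head b) : ∃ φ, IsOptimal tail head ℓ b φ := by
  obtain ⟨φ₀, hφ₀, hpos⟩ := hfeas
  have hcost : Continuous (cost ℓ) := by unfold cost; fun_prop
  have hcl : IsClosed {φ : E → ℝ | (incMatrix tail head).mulVec φ = b} :=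
    isClosed_eq (by fun_prop) continuous_const
  have hcl' : IsClosed {φ : E → ℝ | cost ℓ φ ≤ cost ℓ φ₀} := isClosed_le hcost continuous_const
  have hK : IsCompact (Set.Icc 0 (fun e => cost ℓ φ₀ / ℓ e) ∩
      ({φ : E → ℝ | (incMatrix tail head).mulVec φ = b} ∩ {φ | cost ℓ φ ≤ cost ℓ φ₀})) :=
    isCompact_Icc.inter_right (hcl.inter hcl')
  have hmem : ∀ φ : E → ℝ, IsFlow tail head b φ → (∀ e, 0 ≤ φ e) → cost ℓ φ ≤ cost ℓ φ₀ →
      φ ∈ Set.Icc 0 (fun e => cost ℓ φ₀ / ℓ e) ∩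
      ({φ : E → ℝ | (incMatrix tail head).mulVec φ = b} ∩ {φ | cost ℓ φ ≤ cost ℓ φ₀}) := by
    intro φ h1 h2 h3
    refine ⟨⟨h2, fun e => ?_⟩, h1, h3⟩
    rw [le_div_iff₀ (hℓ e), mul_comm]
    exact (Finset.single_le_sum (f := fun e => ℓ e * φ e)
      (fun e _ => mul_nonneg (hℓ e).le (h2 e)) (Finset.mem_univ e)).trans h3
  obtain ⟨φ, ⟨hIcc, hfl, hle⟩, hmin⟩ :=
    hK.exists_isMinOn ⟨φ₀, hmem φ₀ hφ₀ hpos le_rfl⟩ hcost.continuousOn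
  refine ⟨φ, hfl, hIcc.1, fun ψ h1 h2 => ?_⟩
  by_cases h3 : cost ℓ ψ ≤ cost ℓ φ₀
  · exact hmin (hmem ψ h1 h2 h3)
  · exact hle.trans (not_le.1 h3).le

theorem convex_isOptimal [Fintype E] (ℓ : E → ℝ) (b : V → ℝ) :
    Convex ℝ {φ | IsOptimal tail head ℓ b φ} := by
  rintro φ ⟨h1, h2, h3⟩ ψ ⟨k1, k2, k3⟩ s t hs ht hst
  refine ⟨?_, fun e => ?_, fun χ hχ hχ0 => ?_⟩
  · unfold IsFlow at *
    rw [Matrix.mulVec_add, Matrix.mulVec_smul, Matrix.mulVec_smul, h1, k1, ← add_smul, hst,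
      one_smul]
  · exact add_nonneg (mul_nonneg hs (h2 e)) (mul_nonneg ht (k2 e))
  · have hc : cost ℓ (s • φ + t • ψ) = s * cost ℓ φ + t * cost ℓ ψ := by
      simp only [cost, Pi.add_apply, Pi.smul_apply, smul_eq_mul, Finset.mul_sum,
        ← Finset.sum_add_distrib]
      exact Finset.sum_congr rfl fun e _ => by ring
    rw [hc]
    calc s * cost ℓ φ + t * cost ℓ ψ ≤ s * cost ℓ χ + t * cost ℓ χ := by
          gcongr
          · exact h3 χ hχ hχ0
          · exact k3 χ hχ hχ0
      _ = cost ℓ χ := by rw [← add_mul, hst, one_mul]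

theorem exists_isOptimal_pos_on_optSupport [Fintype E] [Nonempty E] {ℓ : E → ℝ} (hℓ : ∀ e, 0 < ℓ e)
    {b : V → ℝ} (hfeas : Feasible tail head b) :
    ∃ φ, IsOptimal tail head ℓ b φ ∧ ∀ e ∈ optSupport tail head ℓ b, 0 < φ e := by
  have h : ∀ e, ∃ φ, IsOptimal tail head ℓ b φ ∧
      (e ∈ optSupport tail head ℓ b → 0 < φ e) := by
    intro e
    by_cases he : e ∈ optSupport tail head ℓ b
    · obtain ⟨φ, h1, h2⟩ := he
      exact ⟨φ, h1, fun _ => h2⟩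
    · obtain ⟨φ, h1⟩ := exists_isOptimal hℓ hfeas
      exact ⟨φ, h1, fun h => absurd h he⟩
  choose φ hφ hpos using h
  have hcard : (0 : ℝ) < Fintype.card E := by exact_mod_cast Fintype.card_pos
  refine ⟨∑ e, (Fintype.card E : ℝ)⁻¹ • φ e, (convex_isOptimal ℓ b).sum_mem
    (fun _ _ => by positivity) ?_ (fun e _ => hφ e), fun e he => ?_⟩
  · simp [hcard.ne']
  · rw [Finset.sum_apply]
    refine Finset.sum_pos' (fun f _ => mul_nonneg (by positivity) ((hφ f).2.1 e))
      ⟨e, Finset.mem_univ e, mul_pos (by positivity) (hpos e he)⟩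

/-- Strict complementary slackness for an optimal flow of maximal support. -/
theorem exists_strict_complementary [Fintype V] [Fintype E] [DecidableEq E] (hloops : NoLoops tail head) {ℓ : E → ℝ}
    {b : V → ℝ} {φ : E → ℝ} (hφ : IsOptimal tail head ℓ b φ)
    (hmax : ∀ e ∈ optSupport tail head ℓ b, 0 < φ e) :
    ∃ (q : V → ℝ) (r : E → ℝ), (∀ e, ℓ e = r e + (q (tail e) - q (head e))) ∧
      (∀ e, φ e ≠ 0 → r e = 0) ∧ ∀ e, φ e = 0 → 0 < r e := by
  let T : (E → ℝ) →ₗ[ℝ] (Option E → ℝ) := LinearMap.pi fun o => o.elim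
    (-∑ e, ℓ e • LinearMap.proj e) fun e => if φ e = 0 then LinearMap.proj e else 0
  have hTn : ∀ γ, T γ none = -∑ e, ℓ e * γ e := fun γ => by simp [T]
  have hTs : ∀ γ e, T γ (some e) = if φ e = 0 then γ e else 0 := fun γ e => by
    by_cases h : φ e = 0 <;> simp [T, h]
  obtain ⟨y, hy, hyo⟩ := exists_pos_orthogonal_of_no_nonneg
    ((LinearMap.ker (incMatrix tail head).mulVecLin).map T) (by
      rintro _ ⟨γ, hγ, rfl⟩ h0
      have hγ : (incMatrix tail head).mulVec γ = 0 := hγ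
      have hN : ∀ e, φ e = 0 → 0 ≤ γ e := fun e he => by
        have := h0 (some e)
        rwa [hTs, if_pos he] at this
      have hcost : ∑ e, ℓ e * γ e ≤ 0 := by
        have := h0 none
        rw [hTn] at this
        exact neg_nonneg.1 this
      obtain ⟨t, ht, hle⟩ := exists_pos_forall_mul_le (w := φ) (y := -γ) hφ.2.1
        fun e he => neg_nonpos.2 (hN e he)
      have hfl : IsFlow tail head b (φ + t • γ) := by
        rw [IsFlow, Matrix.mulVec_add, Matrix.mulVec_smul, hγ, smul_zero, add_zero]
        exact hφ.1
      have hpos : ∀ e, 0 ≤ (φ + t • γ) e := fun e => by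
        have := hle e
        simp only [Pi.neg_apply, Pi.add_apply, Pi.smul_apply, smul_eq_mul] at *
        linarith
      have hc : cost ℓ (φ + t • γ) = cost ℓ φ + t * ∑ e, ℓ e * γ e := by
        simp only [cost, Pi.add_apply, Pi.smul_apply, smul_eq_mul, Finset.mul_sum,
          ← Finset.sum_add_distrib]
        exact Finset.sum_congr rfl fun e _ => by ring
      have hge := hφ.2.2 _ hfl hpos
      have hcost0 : ∑ e, ℓ e * γ e = 0 := by
        refine le_antisymm hcost ?_
        by_contra h
        push Not at h
        nlinarith [mul_neg_of_pos_of_neg ht h]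
      have hopt : IsOptimal tail head ℓ b (φ + t • γ) := by
        refine ⟨hfl, hpos, fun ψ h1 h2 => ?_⟩
        rw [hc, hcost0, mul_zero, add_zero]
        exact hφ.2.2 ψ h1 h2
      ext o
      cases o with
      | none => simp [hTn, hcost0]
      | some e =>
        rw [hTs]
        split_ifs with he
        · refine le_antisymm ?_ (hN e he)
          by_contra h
          push Not at h
          refine (hmax e ⟨_, hopt, ?_⟩).ne' he
          simp only [Pi.add_apply, Pi.smul_apply, smul_eq_mul, he, zero_add]
          exact mul_pos ht h
        · rfl)
  obtain ⟨q, hq⟩ := exists_potential_of_orthogonal_ker hloops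
    (fun e => ℓ e - if φ e = 0 then y (some e) / y none else 0) (by
      intro γ hγ
      have h := hyo (T γ) ⟨γ, hγ, rfl⟩
      rw [Fintype.sum_option, hTn] at h
      simp only [hTs] at h
      have h2 : ∑ e, (ℓ e - if φ e = 0 then y (some e) / y none else 0) * γ e
          = ∑ e, ℓ e * γ e - (∑ e, y (some e) * if φ e = 0 then γ e else 0) / y none := by
        rw [Finset.sum_div, ← Finset.sum_sub_distrib]
        refine Finset.sum_congr rfl fun e _ => ?_
        split_ifs <;> ring
      have h3 := (hy none).ne'
      rw [h2]
      field_simp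
      linarith)
  refine ⟨q, fun e => if φ e = 0 then y (some e) / y none else 0, fun e => ?_, fun e he => ?_,
    fun e he => ?_⟩
  · rw [← hq]; ring
  · simp [he]
  · simp only [he, if_true]
    exact div_pos (hy _) (hy _)

/-- Two nonnegative arc vectors with nearly equal divergence dominate nonnegative vectors
with equal divergence. -/
theorem exists_balanced_minorants [Fintype V] [Fintype E] (tail head : E → V) :
    ∃ C : ℝ, 0 ≤ C ∧ ∀ x y : E → ℝ, 0 ≤ x → 0 ≤ y → ∃ z u : E → ℝ,
      0 ≤ z ∧ z ≤ x ∧ 0 ≤ u ∧ u ≤ y ∧ (incMatrix tail head).mulVec (z - u) = 0 ∧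
      (∀ e, x e - z e ≤ C * ‖(incMatrix tail head).mulVec (x - y)‖) ∧
      ∀ e, y e - u e ≤ C * ‖(incMatrix tail head).mulVec (x - y)‖ := by
  let D : (E ⊕ E → ℝ) →ₗ[ℝ] (E → ℝ) :=
    LinearMap.funLeft ℝ ℝ Sum.inl - LinearMap.funLeft ℝ ℝ Sum.inr
  obtain ⟨C, hC, h⟩ := exists_conformal_ker ((incMatrix tail head).mulVecLin ∘ₗ D)
  refine ⟨C, hC, fun x y hx hy => ?_⟩
  obtain ⟨w, hw0, hw1, hw, hwC⟩ := h (Sum.elim x y) (by rintro (e | e); exacts [hx e, hy e])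
  have hD : D (Sum.elim x y) = x - y := rfl
  simp only [LinearMap.comp_apply, hD, Matrix.mulVecLin_apply] at hwC
  exact ⟨w ∘ Sum.inl, w ∘ Sum.inr, fun e => hw0 _, fun e => hw1 _, fun e => hw0 _,
    fun e => hw1 _, hw, fun e => hwC (Sum.inl e), fun e => hwC (Sum.inr e)⟩

/-- A circulation can be rerouted outside `P` so that it is controlled by its values on `P`. -/
theorem exists_small_circulation [Fintype V] [Fintype E] (tail head : E → V) (P : E → Prop)
    [DecidablePred P] :
    ∃ C : ℝ, 0 ≤ C ∧ ∀ γ : E → ℝ, (incMatrix tail head).mulVec γ = 0 → ∃ γ' : E → ℝ,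
      (incMatrix tail head).mulVec γ' = 0 ∧ (∀ e, P e → γ' e = γ e) ∧
      ∀ e, |γ' e| ≤ C * ∑ f, if P f then |γ f| else 0 := by
  let R : (E → ℝ) →ₗ[ℝ] (E → ℝ) := LinearMap.pi fun e => if P e then LinearMap.proj e else 0
  have hR : ∀ γ e, R γ e = if P e then γ e else 0 := fun γ e => by
    by_cases h : P e <;> simp [R, h]
  obtain ⟨C, hC, h⟩ := exists_bounded_preimage
    (R ∘ₗ (LinearMap.ker (incMatrix tail head).mulVecLin).subtype)
  refine ⟨C, hC, fun γ hγ => ?_⟩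
  obtain ⟨⟨γ', hγ'⟩, h1, h2⟩ := h ⟨γ, hγ⟩
  have h1 : R γ' = R γ := h1
  have h2 : ‖γ'‖ ≤ C * ‖R γ‖ := h2
  refine ⟨γ', hγ', fun e he => ?_, fun e => ?_⟩
  · have := congrFun h1 e
    simpa [hR, he] using this
  · refine ((norm_le_pi_norm γ' e).trans h2).trans ?_
    have h0 : ∀ f, 0 ≤ if P f then |γ f| else 0 := fun f => by split_ifs <;> positivity
    gcongr
    rw [pi_norm_le_iff_of_nonneg (Finset.sum_nonneg fun f _ => h0 f)]
    intro f
    rw [hR]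
    refine le_trans ?_ (Finset.single_le_sum (fun f _ => h0 f) (Finset.mem_univ f))
    split_ifs <;> simp

theorem cost_sub_cost [Fintype V] [Fintype E] (hloops : NoLoops tail head) {ℓ φ r : E → ℝ}
    {q : V → ℝ} (hr : ∀ e, ℓ e = r e + (q (tail e) - q (head e)))
    (hφr : ∀ e, φ e ≠ 0 → r e = 0) (s : E → ℝ) :
    cost ℓ s - cost ℓ φ = ∑ e, r e * s e + ∑ i, q i * (incMatrix tail head).mulVec (s - φ) i := by
  rw [← sum_mul_potential_sub hloops, cost, cost, ← Finset.sum_sub_distrib,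
    ← Finset.sum_add_distrib]
  refine Finset.sum_congr rfl fun e _ => ?_
  have h : r e * φ e = 0 := by
    by_cases h : φ e = 0
    · rw [h, mul_zero]
    · rw [hφr e h, zero_mul]
  rw [hr e, Pi.sub_apply]
  linear_combination -h

/-- The cost gap is controlled by the weighted deviation of the slopes from `1`. -/
theorem exists_gap_le_deviation [Fintype V] [Fintype E] (hloops : NoLoops tail head)
    {ℓ φ r : E → ℝ} {q : V → ℝ} (hℓ : ∀ e, 0 < ℓ e) (hφ : ∀ e, 0 ≤ φ e)
    (hr : ∀ e, ℓ e = r e + (q (tail e) - q (head e))) (hφr : ∀ e, φ e ≠ 0 → r e = 0)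
    (hrpos : ∀ e, φ e = 0 → 0 < r e) {ε : ℝ} (hε : 0 < ε) {M : ℝ} (hM : 0 ≤ M) :
    ∃ K : ℝ, 0 ≤ K ∧ ∀ (s : E → ℝ) (p : V → ℝ), (∀ e, 0 < s e) → (∀ e, s e ≤ M) →
      (∀ e, φ e ≠ 0 → ε ≤ s e) →
      cost ℓ s - cost ℓ φ ≤ K * (∑ e, s e / ℓ e * (ℓ e - (p (tail e) - p (head e))) ^ 2)
        + K * ‖(incMatrix tail head).mulVec (s - φ)‖ := by
  classical
  obtain ⟨C₁, hC₁, hbal⟩ := exists_balanced_minorants tail head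
  obtain ⟨C₂, hC₂, hcirc⟩ := exists_small_circulation tail head (fun e => φ e = 0)
  obtain ⟨ρ, hρ, hρr⟩ := exists_pos_forall_le hrpos
  have hr0 : ∀ e, 0 ≤ r e := fun e => by
    by_cases h : φ e = 0
    · exact (hrpos e h).le
    · exact (hφr e h).ge
  set G : ℝ := Fintype.card E * M with hG
  have hG0 : 0 ≤ G := by positivity
  set K₁ : ℝ := 1 + C₂ ^ 2 * G / ε with hK₁
  have hK₁0 : 0 ≤ K₁ := by positivity
  set L : ℝ := ∑ e, ℓ e with hL
  have hL0 : 0 ≤ L := Finset.sum_nonneg fun e _ => (hℓ e).le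
  have hR0 : 0 ≤ ∑ e, r e := Finset.sum_nonneg fun e _ => hr0 e
  have hQ0 : 0 ≤ ∑ i, |q i| := by positivity
  refine ⟨L * K₁ / ρ + ((∑ e, r e) * C₁ + ∑ i, |q i|), by positivity,
    fun s p hs hsM hsε => ?_⟩
  set η := ‖(incMatrix tail head).mulVec (s - φ)‖ with hη
  have hη0 : 0 ≤ η := norm_nonneg _
  set T := ∑ e, s e / ℓ e * (ℓ e - (p (tail e) - p (head e))) ^ 2 with hT
  have hTt : ∀ e, 0 ≤ s e / ℓ e * (ℓ e - (p (tail e) - p (head e))) ^ 2 := fun e =>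
    mul_nonneg (div_nonneg (hs e).le (hℓ e).le) (sq_nonneg _)
  have hT0 : 0 ≤ T := Finset.sum_nonneg fun e _ => hTt e
  obtain ⟨z, u, hz0, hzs, hu0, huφ, hzu, hzC, -⟩ := hbal s φ (fun e => (hs e).le) hφ
  have hu : ∀ e, φ e = 0 → u e = 0 := fun e he => le_antisymm (he ▸ huφ e) (hu0 e)
  obtain ⟨γ, hγ, hγN, hγC⟩ := hcirc (z - u) hzu
  set Γ := ∑ f, if φ f = 0 then |(z - u) f| else 0 with hΓ
  have hterm : ∀ f, (if φ f = 0 then |(z - u) f| else 0) = if φ f = 0 then z f else 0 := by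
    intro f
    split_ifs with h
    · rw [Pi.sub_apply, hu f h, sub_zero, abs_of_nonneg (hz0 f)]
    · rfl
  simp only [hterm] at hΓ
  have hΓt : ∀ f, 0 ≤ if φ f = 0 then z f else 0 := fun f => by
    split_ifs
    exacts [hz0 f, le_rfl]
  have hΓ0 : 0 ≤ Γ := hΓ ▸ Finset.sum_nonneg fun f _ => hΓt f
  have hΓG : Γ ≤ G := by
    rw [hΓ, hG, ← nsmul_eq_mul, ← Finset.card_univ]
    refine Finset.sum_le_card_nsmul _ _ _ fun f _ => ?_
    split_ifs
    exacts [(hzs f).trans (hsM f), hM]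
  set Z := ∑ e, r e * z e with hZ
  have hρΓ : ρ * Γ ≤ Z := by
    rw [hΓ, hZ, Finset.mul_sum]
    refine Finset.sum_le_sum fun e _ => ?_
    split_ifs with h
    · exact mul_le_mul_of_nonneg_right (hρr e h) (hz0 e)
    · rw [mul_zero]
      exact mul_nonneg (hr0 e) (hz0 e)
  have hZ0 : 0 ≤ Z := (mul_nonneg hρ.le hΓ0).trans hρΓ
  have hγz : ∀ e, φ e = 0 → γ e = z e := fun e he => by
    rw [hγN e he, Pi.sub_apply, hu e he, sub_zero]
  have hsq : ∀ e, γ e ^ 2 ≤ K₁ * s e * Γ := by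
    intro e
    have hse := (hs e).le
    by_cases he : φ e = 0
    · have h1 : z e ≤ Γ := by
        have := Finset.single_le_sum (fun f _ => hΓt f) (Finset.mem_univ e)
        rwa [← hΓ, if_pos he] at this
      have h2 : (1 : ℝ) ≤ K₁ := by
        rw [hK₁]
        exact le_add_of_nonneg_right (by positivity)
      calc γ e ^ 2 = 1 * z e * z e := by rw [hγz e he]; ring
        _ ≤ K₁ * s e * Γ := mul_le_mul (mul_le_mul h2 (hzs e) (hz0 e) hK₁0) h1 (hz0 e)
          (mul_nonneg hK₁0 hse)
    · have h1 : 1 ≤ s e / ε := (one_le_div hε).2 (hsε e he)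
      calc γ e ^ 2 = |γ e| ^ 2 := (sq_abs _).symm
        _ ≤ (C₂ * Γ) ^ 2 := by gcongr; exact hγC e
        _ = C₂ ^ 2 * Γ * Γ * 1 := by ring
        _ ≤ C₂ ^ 2 * G * Γ * (s e / ε) := by gcongr
        _ = (C₂ ^ 2 * G / ε) * s e * Γ := by ring
        _ ≤ K₁ * s e * Γ := by gcongr; rw [hK₁]; linarith
  have hZeq : Z = ∑ e, γ e * (ℓ e - (p (tail e) - p (head e))) := by
    have h1 := sum_mul_potential_sub hloops p γ
    have h2 := sum_mul_potential_sub hloops q γ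
    simp only [hγ, Pi.zero_apply, mul_zero, Finset.sum_const_zero] at h1 h2
    have h3 : Z = ∑ e, γ e * r e := by
      refine Finset.sum_congr rfl fun e _ => ?_
      by_cases he : φ e = 0
      · rw [hγz e he, mul_comm]
      · rw [hφr e he, zero_mul, mul_zero]
    have h4 : ∀ e, γ e * r e = γ e * (ℓ e - (p (tail e) - p (head e)))
        + γ e * (p (tail e) - p (head e)) - γ e * (q (tail e) - q (head e)) := fun e => by
      rw [hr e]
      ring
    rw [h3, Finset.sum_congr rfl fun e _ => h4 e, Finset.sum_sub_distrib, Finset.sum_add_distrib,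
      h1, h2, add_zero, sub_zero]
  have hCS : Z ^ 2 ≤ T * ∑ e, ℓ e * γ e ^ 2 / s e := by
    rw [hZeq, hT]
    refine Finset.sum_sq_le_sum_mul_sum_of_sq_le_mul _ (fun e _ => hTt e) (fun e _ => ?_)
      fun e _ => ?_
    · have := hs e
      have := hℓ e
      positivity
    · have h1 := (hs e).ne'
      have h2 := (hℓ e).ne'
      apply le_of_eq
      field_simp
  have hsum : ∑ e, ℓ e * γ e ^ 2 / s e ≤ L * K₁ / ρ * Z := by
    calc ∑ e, ℓ e * γ e ^ 2 / s e ≤ ∑ e, ℓ e * (K₁ * Γ) := by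
          refine Finset.sum_le_sum fun e _ => ?_
          rw [div_le_iff₀ (hs e), mul_assoc]
          refine mul_le_mul_of_nonneg_left ((hsq e).trans_eq (by ring)) (hℓ e).le
      _ = L * K₁ / ρ * (ρ * Γ) := by
          rw [← Finset.sum_mul, ← hL]
          field_simp
      _ ≤ L * K₁ / ρ * Z := by gcongr
  have hZT : Z ≤ L * K₁ / ρ * T := by
    rcases hZ0.eq_or_lt with h | h
    · rw [← h]
      positivity
    · have h1 : Z * Z ≤ L * K₁ / ρ * T * Z := by
        calc Z * Z = Z ^ 2 := (sq Z).symm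
          _ ≤ T * (L * K₁ / ρ * Z) := hCS.trans (mul_le_mul_of_nonneg_left hsum hT0)
          _ = _ := by ring
      exact le_of_mul_le_mul_right h1 h
  have hrs : ∑ e, r e * s e ≤ Z + (∑ e, r e) * C₁ * η := by
    rw [hZ, mul_assoc, Finset.sum_mul, ← Finset.sum_add_distrib]
    refine Finset.sum_le_sum fun e _ => ?_
    rw [← mul_add]
    have := hzC e
    exact mul_le_mul_of_nonneg_left (by linarith) (hr0 e)
  have hq := (le_abs_self _).trans (abs_sum_mul_le q ((incMatrix tail head).mulVec (s - φ)))
  rw [cost_sub_cost hloops hr hφr]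
  have h1 : 0 ≤ ((∑ e, r e) * C₁ + ∑ i, |q i|) * T := by positivity
  have h2 : 0 ≤ L * K₁ / ρ * η := by positivity
  linarith

/-- The divergence defect `B (s - φ)` is realised by an arc vector that is small relative
to `s`. -/
theorem exists_small_divergence_rep [Fintype V] [Fintype E] (tail head : E → V)
    {φ : E → ℝ} (hφ : ∀ e, 0 ≤ φ e) {ε : ℝ} (hε : 0 < ε) {M : ℝ} (hM : 0 ≤ M) :
    ∃ K : ℝ, 0 ≤ K ∧ ∀ s : E → ℝ, (∀ e, 0 < s e) → (∀ e, φ e ≠ 0 → ε ≤ s e) →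
      ‖(incMatrix tail head).mulVec (s - φ)‖ ≤ M →
      ∃ v : E → ℝ, (incMatrix tail head).mulVec v = (incMatrix tail head).mulVec (s - φ) ∧
        (∀ e, |v e| ≤ K * ‖(incMatrix tail head).mulVec (s - φ)‖) ∧
        ∀ e, v e ^ 2 ≤ K * ‖(incMatrix tail head).mulVec (s - φ)‖ * s e := by
  obtain ⟨C, hC, hbal⟩ := exists_balanced_minorants tail head
  refine ⟨C + C ^ 2 * M / ε, by positivity, fun s hs hsε hηM => ?_⟩
  set η := ‖(incMatrix tail head).mulVec (s - φ)‖ with hη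
  have hη0 : 0 ≤ η := norm_nonneg _
  obtain ⟨z, u, hz0, hzs, hu0, huφ, hzu, hzC, huC⟩ := hbal s φ (fun e => (hs e).le) hφ
  have hK : C ≤ C + C ^ 2 * M / ε := le_add_of_nonneg_right (by positivity)
  have hve : ∀ e, ((s - φ) - (z - u)) e = (s e - z e) - (φ e - u e) := fun e => by
    simp only [Pi.sub_apply]
    ring
  have hv : ∀ e, |((s - φ) - (z - u)) e| ≤ C * η := fun e => by
    have h1 := sub_nonneg.2 (hzs e)
    have h2 := sub_nonneg.2 (huφ e)
    rw [hve, abs_le]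
    constructor <;> linarith [hzC e, huC e]
  refine ⟨(s - φ) - (z - u), by rw [Matrix.mulVec_sub _ (s - φ), hzu, sub_zero], fun e =>
    (hv e).trans (by gcongr), fun e => ?_⟩
  have hse := (hs e).le
  by_cases he : φ e = 0
  · have h1 := sub_nonneg.2 (hzs e)
    have hu : u e = 0 := le_antisymm (he ▸ huφ e :) (hu0 e)
    have h2 : ((s - φ) - (z - u)) e = s e - z e := by rw [hve, hu, he, sub_zero, sub_zero]
    calc ((s - φ) - (z - u)) e ^ 2 = (s e - z e) * (s e - z e) := by rw [h2, sq]
      _ ≤ (C * η) * s e := mul_le_mul (hzC e) (sub_le_self _ (hz0 e)) h1 (by positivity)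
      _ ≤ (C + C ^ 2 * M / ε) * η * s e := by gcongr
  · have h4 : 1 ≤ s e / ε := (one_le_div hε).2 (hsε e he)
    calc ((s - φ) - (z - u)) e ^ 2 = |((s - φ) - (z - u)) e| ^ 2 := (sq_abs _).symm
      _ ≤ (C * η) ^ 2 := by gcongr; exact hv e
      _ = C ^ 2 * η * η * 1 := by ring
      _ ≤ C ^ 2 * M * η * (s e / ε) := by gcongr
      _ = (C ^ 2 * M / ε) * η * s e := by ring
      _ ≤ (C + C ^ 2 * M / ε) * η * s e := by gcongr; linarith

theorem sum_mul_sq_div_le [Fintype E] {ℓ s v : E → ℝ} (hℓ : ∀ e, 0 < ℓ e) (hs : ∀ e, 0 < s e)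
    {k : ℝ} (hv : ∀ e, v e ^ 2 ≤ k * s e) : ∑ e, ℓ e * v e ^ 2 / s e ≤ (∑ e, ℓ e) * k := by
  rw [Finset.sum_mul]
  refine Finset.sum_le_sum fun e _ => ?_
  rw [div_le_iff₀ (hs e), mul_assoc]
  exact mul_le_mul_of_nonneg_left (hv e) (hℓ e).le

/-- Pairing the potential with the divergence defect costs at most half of the weighted
deviation of the slopes from `1`. -/
theorem exists_neg_pairing_le [Fintype V] [Fintype E] (hloops : NoLoops tail head)
    {ℓ φ : E → ℝ} (hℓ : ∀ e, 0 < ℓ e) (hφ : ∀ e, 0 ≤ φ e)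
    {ε : ℝ} (hε : 0 < ε) {M : ℝ} (hM : 0 ≤ M) :
    ∃ K : ℝ, 0 ≤ K ∧ ∀ (s : E → ℝ) (p : V → ℝ), (∀ e, 0 < s e) → (∀ e, φ e ≠ 0 → ε ≤ s e) →
      ‖(incMatrix tail head).mulVec (s - φ)‖ ≤ M →
      -∑ i, p i * (incMatrix tail head).mulVec (s - φ) i ≤
        (∑ e, s e / ℓ e * (ℓ e - (p (tail e) - p (head e))) ^ 2) / 2
        + K * ‖(incMatrix tail head).mulVec (s - φ)‖ := by
  obtain ⟨K, hK, hrep⟩ := exists_small_divergence_rep tail head hφ hε hM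
  have hL0 : 0 ≤ ∑ e, ℓ e := Finset.sum_nonneg fun e _ => (hℓ e).le
  refine ⟨(∑ e, ℓ e) * K + (∑ e, ℓ e) * K / 2, by positivity, fun s p hs hsε hηM => ?_⟩
  obtain ⟨v, hv, hvabs, hvsq⟩ := hrep s hs hsε hηM
  set η := ‖(incMatrix tail head).mulVec (s - φ)‖ with hη
  rw [← hv, ← sum_mul_potential_sub hloops, ← Finset.sum_neg_distrib]
  have hterm : ∀ e, -(v e * (p (tail e) - p (head e))) ≤
      (s e / ℓ e * (ℓ e - (p (tail e) - p (head e))) ^ 2) / 2 + ℓ e * (K * η)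
        + (ℓ e * v e ^ 2 / s e) / 2 := by
    intro e
    have h1 := (hs e).ne'
    have h2 := (hℓ e).ne'
    have h3 : 0 ≤ s e / ℓ e * (ℓ e - (p (tail e) - p (head e)) - ℓ e * v e / s e) ^ 2 :=
      mul_nonneg (div_nonneg (hs e).le (hℓ e).le) (sq_nonneg _)
    have h4 : s e / ℓ e * (ℓ e - (p (tail e) - p (head e)) - ℓ e * v e / s e) ^ 2
        = s e / ℓ e * (ℓ e - (p (tail e) - p (head e))) ^ 2
          - 2 * v e * (ℓ e - (p (tail e) - p (head e))) + ℓ e * v e ^ 2 / s e := by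
      field_simp
      ring
    have h5 := mul_le_mul_of_nonneg_left ((neg_le_abs _).trans (hvabs e)) (hℓ e).le
    linarith
  have h := Finset.sum_le_sum fun e (_ : e ∈ Finset.univ) => hterm e
  rw [Finset.sum_add_distrib, Finset.sum_add_distrib, ← Finset.sum_mul, ← Finset.sum_div,
    ← Finset.sum_div] at h
  have h1 := sum_mul_sq_div_le hℓ hs hvsq
  linarith

/-- The weighted deviation of the slopes from `1` is controlled by the cost gap. -/
theorem exists_deviation_le_gap [Fintype V] [Fintype E] (hloops : NoLoops tail head)
    {ℓ φ r : E → ℝ} {q : V → ℝ} (hℓ : ∀ e, 0 < ℓ e) (hφ : ∀ e, 0 ≤ φ e)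
    (hr : ∀ e, ℓ e = r e + (q (tail e) - q (head e))) (hφr : ∀ e, φ e ≠ 0 → r e = 0)
    (hr0 : ∀ e, 0 ≤ r e) {ε : ℝ} (hε : 0 < ε) {M : ℝ} (hM : 0 ≤ M) :
    ∃ R K : ℝ, 0 ≤ R ∧ 0 ≤ K ∧ ∀ (s : E → ℝ) (p : V → ℝ), (∀ e, 0 < s e) →
      (∀ e, φ e ≠ 0 → ε ≤ s e) →
      (incMatrix tail head).mulVec (fun e => s e * field tail head ℓ p e)
        = (incMatrix tail head).mulVec φ →
      ‖(incMatrix tail head).mulVec (s - φ)‖ ≤ M →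
      ∑ e, s e / ℓ e * (ℓ e - (p (tail e) - p (head e))) ^ 2 ≤ R * (cost ℓ s - cost ℓ φ)
        + K * ‖(incMatrix tail head).mulVec (s - φ)‖ := by
  obtain ⟨K₁, hK₁0, hrep⟩ := exists_small_divergence_rep tail head hφ hε hM
  set L : ℝ := ∑ e, ℓ e with hL
  have hL0 : 0 ≤ L := Finset.sum_nonneg fun e _ => (hℓ e).le
  have hrℓ : ∀ e, 0 ≤ r e / ℓ e := fun e => div_nonneg (hr0 e) (hℓ e).le
  set R : ℝ := ∑ e, r e / ℓ e with hR
  have hR0 : 0 ≤ R := Finset.sum_nonneg fun e _ => hrℓ e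
  have hQ0 : 0 ≤ ∑ i, |q i| := by positivity
  refine ⟨R, R * (∑ i, |q i|) + L * K₁, hR0, by positivity, fun s p hs hsε hcur hηM => ?_⟩
  set η := ‖(incMatrix tail head).mulVec (s - φ)‖ with hη
  have hη0 : 0 ≤ η := norm_nonneg _
  obtain ⟨v, hv, -, hsq⟩ := hrep s hs hsε hηM
  have hvd : ∑ e, (s e - s e * field tail head ℓ p e)
        * ((p - q) (tail e) - (p - q) (head e))
      = ∑ e, v e * ((p - q) (tail e) - (p - q) (head e)) := by
    rw [sum_mul_potential_sub hloops, sum_mul_potential_sub hloops,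
      show (fun e => s e - s e * field tail head ℓ p e)
        = s - fun e => s e * field tail head ℓ p e from rfl, Matrix.mulVec_sub, hcur, hv,
      Matrix.mulVec_sub]
  have hterm : ∀ e, s e / ℓ e * (ℓ e - (p (tail e) - p (head e))) ^ 2 ≤
      s e / ℓ e * r e ^ 2 - 2 * ((s e - s e * field tail head ℓ p e)
        * ((p - q) (tail e) - (p - q) (head e)))
      + 2 * (v e * ((p - q) (tail e) - (p - q) (head e))) + ℓ e * v e ^ 2 / s e := by
    intro e
    have h1 := (hs e).ne'
    have h2 := (hℓ e).ne'
    have h3 : 0 ≤ s e / ℓ e * ((p - q) (tail e) - (p - q) (head e) + ℓ e * v e / s e) ^ 2 :=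
      mul_nonneg (div_nonneg (hs e).le (hℓ e).le) (sq_nonneg _)
    have h4 : r e = ℓ e - (q (tail e) - q (head e)) := by linarith [hr e]
    have h5 : s e / ℓ e * r e ^ 2 - 2 * ((s e - s e * field tail head ℓ p e)
        * ((p - q) (tail e) - (p - q) (head e)))
      + 2 * (v e * ((p - q) (tail e) - (p - q) (head e))) + ℓ e * v e ^ 2 / s e
      = s e / ℓ e * (ℓ e - (p (tail e) - p (head e))) ^ 2
        + s e / ℓ e * ((p - q) (tail e) - (p - q) (head e) + ℓ e * v e / s e) ^ 2 := by
      rw [h4, field]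
      simp only [Pi.sub_apply]
      field_simp
      ring
    linarith
  have hT := Finset.sum_le_sum fun e (_ : e ∈ Finset.univ) => hterm e
  rw [Finset.sum_add_distrib, Finset.sum_add_distrib, Finset.sum_sub_distrib, ← Finset.mul_sum,
    ← Finset.mul_sum, hvd, sub_add_cancel] at hT
  have hv := sum_mul_sq_div_le hℓ hs hsq
  have hrs : ∑ e, s e / ℓ e * r e ^ 2 ≤ R * ∑ e, r e * s e := by
    rw [Finset.mul_sum]
    refine Finset.sum_le_sum fun e _ => ?_
    calc s e / ℓ e * r e ^ 2 = r e / ℓ e * (r e * s e) := by ring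
      _ ≤ R * (r e * s e) := mul_le_mul_of_nonneg_right
        (Finset.single_le_sum (fun e _ => hrℓ e) (Finset.mem_univ e))
        (mul_nonneg (hr0 e) (hs e).le)
  have hgap := cost_sub_cost hloops hr hφr s
  have hq := (neg_le_neg (abs_sum_mul_le q ((incMatrix tail head).mulVec (s - φ)))).trans
    (neg_abs_le _)
  have h1 : R * ∑ e, r e * s e ≤ R * ((cost ℓ s - cost ℓ φ) + (∑ i, |q i|) * η) :=
    mul_le_mul_of_nonneg_left (by linarith) hR0
  linarith

theorem abs_current_le [Fintype V] [Fintype E] (hloops : NoLoops tail head) {ℓ s : E → ℝ}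
    {b p : V → ℝ} (hℓ : ∀ e, 0 < ℓ e) (hs : ∀ e, 0 < s e)
    (hcur : IsFlow tail head b fun e => s e * field tail head ℓ p e) (e : E) :
    |s e * field tail head ℓ p e| ≤ ∑ i, |b i| := by
  have hb0 : 0 ≤ ∑ i, |b i| := by positivity
  let χ : V → ℝ := fun i => if max (p (tail e)) (p (head e)) ≤ p i then 1 else 0
  have hsum := sum_mul_potential_sub hloops χ fun e => s e * field tail head ℓ p e
  rw [show (incMatrix tail head).mulVec _ = b from hcur] at hsum
  have hcut : ∑ i, χ i * b i ≤ ∑ i, |b i| := by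
    refine Finset.sum_le_sum fun i _ => ?_
    simp only [χ]
    split_ifs
    · simpa using le_abs_self (b i)
    · simp
  have hterm : ∀ f, 0 ≤ s f * field tail head ℓ p f * (χ (tail f) - χ (head f)) := by
    intro f
    have h : 0 ≤ (p (tail f) - p (head f)) * (χ (tail f) - χ (head f)) := by
      simp only [χ]
      split_ifs with h1 h2 h2
      · simp
      · rw [sub_zero, mul_one]
        linarith [lt_of_lt_of_le (not_le.1 h2) h1]
      · rw [zero_sub, mul_neg_one]
        linarith [lt_of_lt_of_le (not_le.1 h1) h2]
      · simp
    have h2 := mul_nonneg (div_nonneg (hs f).le (hℓ f).le) h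
    rw [field]
    calc 0 ≤ _ := h2
      _ = _ := by ring
  have hle := (Finset.single_le_sum (fun f _ => hterm f) (Finset.mem_univ e)).trans
    (hsum.trans_le hcut)
  rcases lt_trichotomy (p (tail e)) (p (head e)) with h | h | h
  · have hχ : χ (tail e) - χ (head e) = -1 := by
      simp [χ, h.not_ge]
      simp [h.le]
    have hfield : s e * field tail head ℓ p e ≤ 0 :=
      mul_nonpos_of_nonneg_of_nonpos (hs e).le
        (div_nonpos_of_nonpos_of_nonneg (sub_nonpos.2 h.le) (hℓ e).le)
    rw [abs_of_nonpos hfield]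
    rw [hχ] at hle
    linarith
  · simpa [field, h] using hb0
  · have hχ : χ (tail e) - χ (head e) = 1 := by
      simp [χ, h.not_ge]
      simp [h.le]
    have hfield : 0 ≤ s e * field tail head ℓ p e :=
      mul_nonneg (hs e).le (div_nonneg (sub_nonneg.2 h.le) (hℓ e).le)
    rw [abs_of_nonneg hfield]
    rw [hχ] at hle
    linarith

end Network

theorem le_initial_of_hasDerivWithinAt_nonpos {f f' : ℝ → ℝ}
    (hf : ∀ t ∈ Set.Ici (0 : ℝ), HasDerivWithinAt f (f' t) (Set.Ici 0) t)
    (hf' : ∀ t, 0 ≤ t → f' t ≤ 0) {t : ℝ} (ht : 0 ≤ t) : f t ≤ f 0 := by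
  refine antitoneOn_of_hasDerivWithinAt_nonpos (convex_Ici (0 : ℝ)) (f' := f')
    (fun t ht => (hf t ht).continuousWithinAt) (fun t ht => ?_) (fun t ht => ?_)
    Set.self_mem_Ici ht ht
  · exact (hf t (interior_subset ht)).mono interior_subset
  · exact hf' t (interior_subset ht)

theorem hasDerivWithinAt_exp_mul (a : ℝ) (s : Set ℝ) (t : ℝ) :
    HasDerivWithinAt (fun t => Real.exp (a * t)) (a * Real.exp (a * t)) s t := by
  have h := ((hasDerivAt_id t).const_mul a).exp.hasDerivWithinAt (s := s)
  simpa [mul_comm] using h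

theorem exp_relaxation_le {f g : ℝ → ℝ} {c : ℝ}
    (hf : ∀ t ∈ Set.Ici (0 : ℝ), HasDerivWithinAt f (g t - f t) (Set.Ici 0) t)
    (hg : ∀ t, 0 ≤ t → g t ≤ c) {t : ℝ} (ht : 0 ≤ t) :
    f t - c ≤ Real.exp (-t) * (f 0 - c) := by
  have h := le_initial_of_hasDerivWithinAt_nonpos
    (fun t ht => (hasDerivWithinAt_exp_mul 1 (Set.Ici 0) t).mul ((hf t ht).sub_const c))
    (fun t ht => by
      have h1 := hg t ht
      have h2 := Real.exp_pos (1 * t)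
      calc _ = Real.exp (1 * t) * (g t - c) := by ring
        _ ≤ 0 := mul_nonpos_of_nonneg_of_nonpos h2.le (by linarith)) ht
  simp only [Pi.mul_apply, one_mul, Real.exp_zero] at h
  calc f t - c = Real.exp (-t) * (Real.exp t * (f t - c)) := by
        rw [← mul_assoc, ← Real.exp_add, neg_add_cancel, Real.exp_zero, one_mul]
    _ ≤ _ := by gcongr

theorem exp_relaxation_eq {f : ℝ → ℝ} {c : ℝ}
    (hf : ∀ t ∈ Set.Ici (0 : ℝ), HasDerivWithinAt f (c - f t) (Set.Ici 0) t)
    {t : ℝ} (ht : 0 ≤ t) : f t - c = Real.exp (-t) * (f 0 - c) := by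
  refine le_antisymm (exp_relaxation_le hf (fun _ _ => le_rfl) ht) ?_
  have h := exp_relaxation_le (f := fun t => -f t) (g := fun _ => -c) (c := -c)
    (fun t ht => (hf t ht).neg.congr_deriv (by ring)) (fun _ _ => le_rfl) ht
  linarith

theorem exists_exp_decay {U U' T : ℝ → ℝ} {K c : ℝ} (hK : 1 ≤ K) (hc : 0 ≤ c)
    (hU : ∀ t ∈ Set.Ici (0 : ℝ), HasDerivWithinAt U (U' t) (Set.Ici 0) t)
    (hU' : ∀ t, 0 ≤ t → U' t ≤ -(T t / 2) + c * Real.exp (-t))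
    (hUT : ∀ t, 0 ≤ t → U t ≤ K * T t + c * Real.exp (-t))
    (hlow : ∀ t, 0 ≤ t → -(c * Real.exp (-t)) ≤ U t) :
    ∃ C a : ℝ, 0 ≤ C ∧ 0 < a ∧ a ≤ 1 ∧ ∀ t, 0 ≤ t → U t ≤ C * Real.exp (-a * t) := by
  set a : ℝ := 1 / (4 * K) with ha
  have hK0 : 0 < K := by linarith
  have ha0 : 0 < a := by positivity
  have ha1 : a ≤ 1 / 4 := by
    rw [ha]
    exact one_div_le_one_div_of_le (by norm_num) (by linarith)
  have haK : a * K = 1 / 4 := by rw [ha]; field_simp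
  have h1a : 0 < 1 - a := by linarith
  have hkey : ∀ t, 0 ≤ t → a * U t + U' t ≤ 2 * c * Real.exp (-t) := by
    intro t ht
    have hE := mul_nonneg hc (Real.exp_pos (-t)).le
    have h1 := mul_le_mul_of_nonneg_left (hUT t ht) ha0.le
    have h2 := mul_le_mul_of_nonneg_left (hlow t ht) ha0.le
    have h3 := mul_le_mul_of_nonneg_right ha1 hE
    have h4 : a * (K * T t + c * Real.exp (-t)) = T t / 4 + a * (c * Real.exp (-t)) := by
      linear_combination T t * haK
    rw [h4] at h1
    linarith [hU' t ht]
  have hder : ∀ t ∈ Set.Ici (0 : ℝ), HasDerivWithinAt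
      (fun t => Real.exp (a * t) * U t + 2 * c / (1 - a) * Real.exp (-(1 - a) * t))
      (Real.exp (a * t) * (a * U t + U' t - 2 * c * Real.exp (-t))) (Set.Ici 0) t := by
    intro t ht
    refine (((hasDerivWithinAt_exp_mul a _ t).mul (hU t ht)).add
      ((hasDerivWithinAt_exp_mul (-(1 - a)) _ t).const_mul (2 * c / (1 - a)))).congr_deriv ?_
    have h1 : Real.exp (-(1 - a) * t) = Real.exp (a * t) * Real.exp (-t) := by
      rw [← Real.exp_add]
      congr 1
      ring
    rw [h1]
    field_simp
    ring
  refine ⟨|U 0| + 2 * c / (1 - a), a, by positivity, ha0, by linarith, fun t ht => ?_⟩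
  have h := le_initial_of_hasDerivWithinAt_nonpos hder (fun t ht =>
    mul_nonpos_of_nonneg_of_nonpos (Real.exp_pos _).le (by linarith [hkey t ht])) ht
  simp only [mul_zero, Real.exp_zero, one_mul, mul_one] at h
  have h1 : 0 ≤ 2 * c / (1 - a) * Real.exp (-(1 - a) * t) := by positivity
  have h2 : Real.exp (a * t) * U t ≤ |U 0| + 2 * c / (1 - a) := by linarith [le_abs_self (U 0)]
  calc U t = Real.exp (a * t) * U t * Real.exp (-a * t) := by
        rw [mul_right_comm, ← Real.exp_add]
        simp
    _ ≤ _ := by gcongr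

namespace PhysarumDynamics

variable {V E : Type*} [Fintype V] [Fintype E] [DecidableEq V] [DecidableEq E] {tail head : E → V}
  {ℓ : E → ℝ} {b : V → ℝ} {σ : ℝ → E → ℝ} {p : ℝ → V → ℝ}

theorem isFlow_current (h : PhysarumDynamics tail head ℓ b σ p) (hloops : NoLoops tail head)
    {t : ℝ} (ht : 0 ≤ t) : IsFlow tail head b (current tail head ℓ σ p t) :=
  isFlow_of_lap_mulVec hloops (h.kirchhoff t ht)

theorem hasDerivWithinAt_sum_mul (h : PhysarumDynamics tail head ℓ b σ p) (c : E → ℝ) {t : ℝ}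
    (ht : t ∈ Set.Ici (0 : ℝ)) :
    HasDerivWithinAt (fun t => ∑ e, c e * σ t e)
      (∑ e, c e * (current tail head ℓ σ p t e - σ t e)) (Set.Ici 0) t :=
  HasDerivWithinAt.fun_sum fun e _ => (h.dyn t ht e).const_mul (c e)

theorem hasDerivWithinAt_sum_log (h : PhysarumDynamics tail head ℓ b σ p) (hℓ : ∀ e, 0 < ℓ e)
    (g : E → ℝ) {t : ℝ} (ht : t ∈ Set.Ici (0 : ℝ)) :
    HasDerivWithinAt (fun t => ∑ e, ℓ e * g e * Real.log (σ t e))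
      (∑ e, g e * (p t (tail e) - p t (head e)) - cost ℓ g) (Set.Ici 0) t := by
  have hd := HasDerivWithinAt.fun_sum fun e (_ : e ∈ Finset.univ) =>
    ((h.dyn t ht e).log (h.pos t ht e).ne').const_mul (ℓ e * g e)
  refine hd.congr_deriv ?_
  rw [cost, ← Finset.sum_sub_distrib]
  refine Finset.sum_congr rfl fun e _ => ?_
  have h1 := (h.pos t ht e).ne'
  have h2 := (hℓ e).ne'
  rw [current, field]
  field_simp

theorem mulVec_sub_eq (h : PhysarumDynamics tail head ℓ b σ p) (hloops : NoLoops tail head)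
    {φ : E → ℝ} (hφ : IsFlow tail head b φ) {t : ℝ} (ht : 0 ≤ t) :
    (incMatrix tail head).mulVec (σ t - φ)
      = Real.exp (-t) • (incMatrix tail head).mulVec (σ 0 - φ) := by
  ext i
  rw [Matrix.mulVec_sub, Matrix.mulVec_sub, show (incMatrix tail head).mulVec φ = b from hφ]
  refine exp_relaxation_eq (f := fun t => (incMatrix tail head).mulVec (σ t) i)
    (fun t ht => ?_) ht
  refine (h.hasDerivWithinAt_sum_mul (incMatrix tail head i) ht).congr_deriv ?_
  simp only [mul_sub, Finset.sum_sub_distrib]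
  have := congrFun (h.isFlow_current hloops ht) i
  simp only [Matrix.mulVec, dotProduct] at *
  rw [this]

theorem exists_upper_bound (h : PhysarumDynamics tail head ℓ b σ p) (hloops : NoLoops tail head)
    (hℓ : ∀ e, 0 < ℓ e) : ∃ M : ℝ, 1 ≤ M ∧ ∀ t, 0 ≤ t → ∀ e, σ t e ≤ M := by
  have hb0 : 0 ≤ ∑ i, |b i| := by positivity
  have hσ0 : ∀ e, 0 ≤ σ 0 e := fun e => (h.pos 0 le_rfl e).le
  have hσs : 0 ≤ ∑ e, σ 0 e := Finset.sum_nonneg fun e _ => hσ0 e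
  refine ⟨1 + ∑ i, |b i| + ∑ e, σ 0 e, by linarith, fun t ht e => ?_⟩
  have h1 := exp_relaxation_le (f := fun t => σ t e)
    (g := fun t => current tail head ℓ σ p t e) (c := ∑ i, |b i|) (fun t ht => h.dyn t ht e)
    (fun t ht => (le_abs_self _).trans
      (abs_current_le hloops hℓ (h.pos t ht) (h.isFlow_current hloops ht) e)) ht
  have h2 : Real.exp (-t) * (σ 0 e - ∑ i, |b i|) ≤ σ 0 e :=
    (mul_le_mul_of_nonneg_left (sub_le_self _ hb0) (Real.exp_pos _).le).trans
      (mul_le_of_le_one_left (hσ0 e) (Real.exp_le_one_iff.2 (by linarith)))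
  have h3 := Finset.single_le_sum (fun e _ => hσ0 e) (Finset.mem_univ e)
  linarith

theorem cost_sub_ge (h : PhysarumDynamics tail head ℓ b σ p) (hloops : NoLoops tail head)
    {φ r : E → ℝ} {q : V → ℝ} (hφ : IsFlow tail head b φ)
    (hr : ∀ e, ℓ e = r e + (q (tail e) - q (head e))) (hφr : ∀ e, φ e ≠ 0 → r e = 0)
    (hr0 : ∀ e, 0 ≤ r e) {t : ℝ} (ht : 0 ≤ t) :
    -((∑ i, |q i|) * ‖(incMatrix tail head).mulVec (σ 0 - φ)‖ * Real.exp (-t))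
      ≤ cost ℓ (σ t) - cost ℓ φ := by
  have h1 := (neg_le_neg (abs_sum_mul_le q ((incMatrix tail head).mulVec (σ t - φ)))).trans
    (neg_abs_le _)
  rw [cost_sub_cost hloops hr hφr]
  have h2 : 0 ≤ ∑ e, r e * σ t e :=
    Finset.sum_nonneg fun e _ => mul_nonneg (hr0 e) (h.pos t ht e).le
  have h3 : ‖(incMatrix tail head).mulVec (σ t - φ)‖
      = Real.exp (-t) * ‖(incMatrix tail head).mulVec (σ 0 - φ)‖ := by
    rw [h.mulVec_sub_eq hloops hφ ht, norm_smul, Real.norm_of_nonneg (Real.exp_pos _).le]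
  rw [h3] at h1
  linarith

/-- Arcs carrying the reference optimal flow keep their conductivity bounded away from `0`. -/
theorem exists_lower_bound (h : PhysarumDynamics tail head ℓ b σ p) (hloops : NoLoops tail head)
    (hℓ : ∀ e, 0 < ℓ e) {φ r : E → ℝ} {q : V → ℝ} (hφ : IsFlow tail head b φ)
    (hφ0 : ∀ e, 0 ≤ φ e)
    (hr : ∀ e, ℓ e = r e + (q (tail e) - q (head e))) (hφr : ∀ e, φ e ≠ 0 → r e = 0)
    (hr0 : ∀ e, 0 ≤ r e) :
    ∃ ε > (0 : ℝ), ∀ t, 0 ≤ t → ∀ e, φ e ≠ 0 → ε ≤ σ t e := by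
  obtain ⟨M, hM1, hM⟩ := h.exists_upper_bound hloops hℓ
  have hlogM : 0 ≤ Real.log M := Real.log_nonneg hM1
  have hlog : ∀ t, 0 ≤ t → ∀ e, Real.log (σ t e) ≤ Real.log M := fun t ht e =>
    Real.log_le_log (h.pos t ht e) (hM t ht e)
  have hσ0 : ∀ e, 0 < σ 0 e := h.pos 0 le_rfl
  set d := ‖(incMatrix tail head).mulVec (σ 0 - φ)‖ with hd
  let F : ℝ → ℝ := fun t => ∑ e, ℓ e * σ 0 e * Real.log (σ t e)
  let Y : ℝ → ℝ := fun t => ∑ e, ℓ e * φ e * Real.log (σ t e)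
  have hbound : ∀ g : E → ℝ, (∀ e, 0 ≤ g e) → ∀ t, 0 ≤ t →
      ∑ e, ℓ e * g e * Real.log (σ t e) ≤ cost ℓ g * Real.log M := by
    intro g hg t ht
    rw [cost, Finset.sum_mul]
    exact Finset.sum_le_sum fun e _ =>
      mul_le_mul_of_nonneg_left (hlog t ht e) (mul_nonneg (hℓ e).le (hg e))
  have hcost0 : ∀ g : E → ℝ, (∀ e, 0 ≤ g e) → 0 ≤ cost ℓ g := fun g hg =>
    Finset.sum_nonneg fun e _ => mul_nonneg (hℓ e).le (hg e)
  have hF : ∀ t, 0 ≤ t → F t ≤ cost ℓ (σ 0) * Real.log M := hbound _ fun e => (hσ0 e).le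
  have hFM0 : 0 ≤ cost ℓ (σ 0) * Real.log M := mul_nonneg (hcost0 _ fun e => (hσ0 e).le) hlogM
  set k := (∑ i, |q i|) * d + cost ℓ (σ 0) + cost ℓ (σ 0) * Real.log M with hk
  have hk0 : 0 ≤ k := by
    have := hcost0 (σ 0) fun e => (hσ0 e).le
    positivity
  have hder : ∀ t ∈ Set.Ici (0 : ℝ), HasDerivWithinAt
      (fun t => (∑ e, ℓ e * σ t e) - Y t - Real.exp (-1 * t) * F t + k * Real.exp (-1 * t))
      (∑ e, ℓ e * (current tail head ℓ σ p t e - σ t e)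
        - (∑ e, φ e * (p t (tail e) - p t (head e)) - cost ℓ φ)
        - (-1 * Real.exp (-1 * t) * F t
          + Real.exp (-1 * t) * (∑ e, σ 0 e * (p t (tail e) - p t (head e)) - cost ℓ (σ 0)))
        + k * (-1 * Real.exp (-1 * t))) (Set.Ici 0) t := fun t ht =>
    (((h.hasDerivWithinAt_sum_mul ℓ ht).sub (h.hasDerivWithinAt_sum_log hℓ φ ht)).sub
      ((hasDerivWithinAt_exp_mul (-1) _ t).mul (h.hasDerivWithinAt_sum_log hℓ (σ 0) ht))).add
      ((hasDerivWithinAt_exp_mul (-1) _ t).const_mul k)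
  have hnonpos : ∀ t, 0 ≤ t → ∑ e, ℓ e * (current tail head ℓ σ p t e - σ t e)
        - (∑ e, φ e * (p t (tail e) - p t (head e)) - cost ℓ φ)
        - (-1 * Real.exp (-1 * t) * F t
          + Real.exp (-1 * t) * (∑ e, σ 0 e * (p t (tail e) - p t (head e)) - cost ℓ (σ 0)))
        + k * (-1 * Real.exp (-1 * t)) ≤ 0 := by
    intro t ht
    have hE := Real.exp_pos (-t)
    have hφb : (incMatrix tail head).mulVec φ = b := hφ
    have hpb : 0 ≤ ∑ i, p t i * b i := by
      have h1 := sum_mul_potential_sub hloops (p t) (current tail head ℓ σ p t)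
      rw [show (incMatrix tail head).mulVec _ = b from h.isFlow_current hloops ht] at h1
      rw [← h1]
      refine Finset.sum_nonneg fun e _ => ?_
      have h2 : 0 ≤ σ t e / ℓ e * (p t (tail e) - p t (head e)) ^ 2 :=
        mul_nonneg (div_nonneg (h.pos t ht e).le (hℓ e).le) (sq_nonneg _)
      rw [current, field]
      exact h2.trans_eq (by ring)
    have h1 : ∑ e, ℓ e * (current tail head ℓ σ p t e - σ t e)
        = ∑ e, σ t e * (p t (tail e) - p t (head e)) - cost ℓ (σ t) := by
      rw [cost, ← Finset.sum_sub_distrib]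
      refine Finset.sum_congr rfl fun e _ => ?_
      have := (hℓ e).ne'
      rw [current, field]
      field_simp
    have h2 : ∑ i, p t i * (incMatrix tail head).mulVec (σ t) i - ∑ i, p t i * b i
        = Real.exp (-t) * (∑ i, p t i * (incMatrix tail head).mulVec (σ 0) i
          - ∑ i, p t i * b i) := by
      have h3 := h.mulVec_sub_eq hloops hφ ht
      rw [Matrix.mulVec_sub, Matrix.mulVec_sub, hφb] at h3
      rw [← Finset.sum_sub_distrib, ← Finset.sum_sub_distrib, Finset.mul_sum]
      refine Finset.sum_congr rfl fun i _ => ?_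
      have h4 := congrFun h3 i
      simp only [Pi.sub_apply, Pi.smul_apply, smul_eq_mul] at h4
      linear_combination p t i * h4
    have hgap := h.cost_sub_ge hloops hφ hr hφr hr0 ht
    rw [h1, sum_mul_potential_sub hloops, sum_mul_potential_sub hloops,
      sum_mul_potential_sub hloops, hφb, neg_one_mul t]
    have h5 := mul_le_mul_of_nonneg_left (hF t ht) hE.le
    have h6 := mul_nonneg hE.le hpb
    rw [hk]
    linarith
  obtain ⟨c, hc⟩ : ∃ c : ℝ, ∀ t, 0 ≤ t → c ≤ Y t := by
    refine ⟨-((∑ e, ℓ e * σ 0 e) - Y 0 - Real.exp (-1 * 0) * F 0 + k * Real.exp (-1 * 0))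
      - cost ℓ (σ 0) * Real.log M, fun t ht => ?_⟩
    have h1 := le_initial_of_hasDerivWithinAt_nonpos hder hnonpos ht
    have h2 := hcost0 (σ t) fun e => (h.pos t ht e).le
    have h3 : Real.exp (-1 * t) * F t ≤ cost ℓ (σ 0) * Real.log M :=
      (mul_le_mul_of_nonneg_left (hF t ht) (Real.exp_pos _).le).trans
        (mul_le_of_le_one_left hFM0 (Real.exp_le_one_iff.2 (by linarith)))
    have h4 : 0 ≤ k * Real.exp (-1 * t) := by positivity
    rw [cost] at h2
    linarith
  have hε : ∀ e, φ e ≠ 0 → 0 < Real.exp ((c - cost ℓ φ * Real.log M) / (ℓ e * φ e)) :=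
    fun e _ => Real.exp_pos _
  obtain ⟨ε, hε0, hεle⟩ := exists_pos_forall_le hε
  refine ⟨ε, hε0, fun t ht e he => (hεle e he).trans ?_⟩
  have hφe : 0 < φ e := lt_of_le_of_ne (hφ0 e) (Ne.symm he)
  rw [← Real.le_log_iff_exp_le (h.pos t ht e), div_le_iff₀ (mul_pos (hℓ e) hφe)]
  have hterm : ∀ f, 0 ≤ ℓ f * φ f * (Real.log M - Real.log (σ t f)) := fun f =>
    mul_nonneg (mul_nonneg (hℓ f).le (hφ0 f)) (sub_nonneg.2 (hlog t ht f))
  have h1 := Finset.single_le_sum (fun f _ => hterm f) (Finset.mem_univ e)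
  simp only [mul_sub, Finset.sum_sub_distrib, ← Finset.sum_mul] at h1
  have h2 := hc t ht
  have h3 : 0 ≤ ℓ e * φ e * Real.log M := mul_nonneg (mul_nonneg (hℓ e).le (hφ0 e)) hlogM
  simp only [Y] at h2
  rw [cost]
  linarith

theorem exists_deviation_decay (h : PhysarumDynamics tail head ℓ b σ p)
    (hloops : NoLoops tail head)
    (hℓ : ∀ e, 0 < ℓ e) {φ r : E → ℝ} {q : V → ℝ} (hφ : IsFlow tail head b φ)
    (hφ0 : ∀ e, 0 ≤ φ e)
    (hr : ∀ e, ℓ e = r e + (q (tail e) - q (head e))) (hφr : ∀ e, φ e ≠ 0 → r e = 0)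
    (hrpos : ∀ e, φ e = 0 → 0 < r e) :
    ∃ C a : ℝ, 0 ≤ C ∧ 0 < a ∧ ∀ t, 0 ≤ t →
      ∑ e, σ t e / ℓ e * (ℓ e - (p t (tail e) - p t (head e))) ^ 2 ≤ C * Real.exp (-a * t) := by
  have hr0 : ∀ e, 0 ≤ r e := fun e => by
    by_cases he : φ e = 0
    · exact (hrpos e he).le
    · exact (hφr e he).ge
  obtain ⟨M, hM1, hM⟩ := h.exists_upper_bound hloops hℓ
  obtain ⟨ε, hε, hσε⟩ := h.exists_lower_bound hloops hℓ hφ hφ0 hr hφr hr0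
  set d := ‖(incMatrix tail head).mulVec (σ 0 - φ)‖ with hd
  have hd0 : 0 ≤ d := norm_nonneg _
  have hη : ∀ t, 0 ≤ t → ‖(incMatrix tail head).mulVec (σ t - φ)‖ = Real.exp (-t) * d := by
    intro t ht
    rw [h.mulVec_sub_eq hloops hφ ht, norm_smul, Real.norm_of_nonneg (Real.exp_pos _).le]
  have hηd : ∀ t, 0 ≤ t → ‖(incMatrix tail head).mulVec (σ t - φ)‖ ≤ d := by
    intro t ht
    rw [hη t ht]
    exact mul_le_of_le_one_left hd0 (Real.exp_le_one_iff.2 (by linarith))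
  obtain ⟨K₁, hK₁, hgap⟩ := exists_gap_le_deviation hloops hℓ hφ0 hr hφr hrpos hε
    (zero_le_one.trans hM1)
  obtain ⟨R, K₂, hR, hK₂, hdev⟩ := exists_deviation_le_gap hloops hℓ hφ0 hr hφr hr0 hε hd0
  obtain ⟨K₃, hK₃, hpair⟩ := exists_neg_pairing_le hloops hℓ hφ0 hε hd0
  set T : ℝ → ℝ := fun t => ∑ e, σ t e / ℓ e * (ℓ e - (p t (tail e) - p t (head e))) ^ 2 with hT
  have hT0 : ∀ t, 0 ≤ t → 0 ≤ T t := fun t ht => Finset.sum_nonneg fun e _ =>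
    mul_nonneg (div_nonneg (h.pos t ht e).le (hℓ e).le) (sq_nonneg _)
  have hQ0 : 0 ≤ ∑ i, |q i| := by positivity
  have hU' : ∀ t, 0 ≤ t → ∑ e, ℓ e * (current tail head ℓ σ p t e - σ t e)
      = -T t - ∑ i, p t i * (incMatrix tail head).mulVec (σ t - φ) i := by
    intro t ht
    have h1 : (incMatrix tail head).mulVec (σ t - φ)
        = (incMatrix tail head).mulVec (σ t - current tail head ℓ σ p t) := by
      rw [Matrix.mulVec_sub, Matrix.mulVec_sub, show (incMatrix tail head).mulVec φ = b from hφ,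
        show (incMatrix tail head).mulVec _ = b from h.isFlow_current hloops ht]
    rw [h1, ← sum_mul_potential_sub hloops, hT, ← Finset.sum_neg_distrib,
      ← Finset.sum_sub_distrib]
    refine Finset.sum_congr rfl fun e _ => ?_
    have := (hℓ e).ne'
    rw [Pi.sub_apply, current, field]
    field_simp
    ring
  obtain ⟨C, a, hC, ha, ha1, hdecay⟩ := exists_exp_decay
    (U := fun t => cost ℓ (σ t) - cost ℓ φ)
    (U' := fun t => ∑ e, ℓ e * (current tail head ℓ σ p t e - σ t e)) (T := T)
    (K := K₁ + 1) (c := (K₁ + K₃ + ∑ i, |q i|) * d) (by linarith) (by positivity)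
    (fun t ht => (h.hasDerivWithinAt_sum_mul ℓ ht).sub_const _)
    (fun t ht => by
      have h1 := hpair (σ t) (p t) (h.pos t ht) (hσε t ht) (hηd t ht)
      rw [hη t ht] at h1
      rw [hU' t ht]
      have h2 : 0 ≤ (K₁ + ∑ i, |q i|) * d * Real.exp (-t) := by positivity
      linarith)
    (fun t ht => by
      have h1 := hgap (σ t) (p t) (h.pos t ht) (hM t ht) (hσε t ht)
      rw [hη t ht] at h1
      have h2 : 0 ≤ (K₃ + ∑ i, |q i|) * d * Real.exp (-t) := by positivity
      linarith [hT0 t ht])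
    (fun t ht => by
      have h1 := h.cost_sub_ge hloops hφ hr hφr hr0 ht
      have h2 : 0 ≤ (K₁ + K₃) * d * Real.exp (-t) := by positivity
      linarith)
  refine ⟨R * C + K₂ * d, a, by positivity, ha, fun t ht => ?_⟩
  have h1 := hdev (σ t) (p t) (h.pos t ht) (hσε t ht)
    ((h.isFlow_current hloops ht).trans hφ.symm) (hηd t ht)
  rw [hη t ht] at h1
  have h2 := mul_le_mul_of_nonneg_left (hdecay t ht) hR
  have h3 : Real.exp (-t) ≤ Real.exp (-a * t) := Real.exp_le_exp.2 (by nlinarith)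
  have h4 := mul_le_mul_of_nonneg_left h3 (mul_nonneg hK₂ hd0)
  linarith

end PhysarumDynamics

theorem statement_13 {V E : Type*} [Fintype V] [Fintype E] [DecidableEq V] [DecidableEq E]
    (tail head : E → V)
    (hloops : NoLoops tail head) (hmult : NoMultiple tail head)
    (hconn : IsConnectedGraph tail head)
    (ℓ : E → ℝ) (hℓ : ∀ e, 0 < ℓ e)
    (b : V → ℝ) (hb : ∑ i, b i = 0)
    (hfeas : Feasible tail head b)
    (σ : ℝ → E → ℝ) (p : ℝ → V → ℝ)
    (hdyn : PhysarumDynamics tail head ℓ b σ p) :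
    ∃ C > (0:ℝ), ∃ a > (0:ℝ), ∀ t : ℝ, 0 ≤ t →
      ∀ e ∈ optSupport tail head ℓ b,
        |field tail head ℓ (p t) e - 1| ≤ C * Real.exp (-a * t) := by
  rcases isEmpty_or_nonempty E with hE | hE
  · exact ⟨1, one_pos, 1, one_pos, fun t _ e => hE.elim e⟩
  obtain ⟨φ, hφ, hmax⟩ := exists_isOptimal_pos_on_optSupport hℓ hfeas
  obtain ⟨q, r, hr, hφr, hrpos⟩ := exists_strict_complementary hloops hφ hmax
  have hr0 : ∀ e, 0 ≤ r e := fun e => by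
    by_cases he : φ e = 0
    · exact (hrpos e he).le
    · exact (hφr e he).ge
  obtain ⟨ε, hε, hσε⟩ := hdyn.exists_lower_bound hloops hℓ hφ.1 hφ.2.1 hr hφr hr0
  obtain ⟨C, a, hC, ha, hT⟩ := hdyn.exists_deviation_decay hloops hℓ hφ.1 hφ.2.1 hr hφr hrpos
  obtain ⟨m, hm, hmℓ⟩ := exists_pos_forall_le (P := fun _ => True) fun e _ => hℓ e
  refine ⟨Real.sqrt (C / (m * ε)) + 1, by positivity, a / 2, by positivity, fun t ht e he => ?_⟩
  have hσe := hσε t ht e (hmax e he).ne'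
  have hσ0 := hdyn.pos t ht e
  have h1 : σ t e / ℓ e * (ℓ e - (p t (tail e) - p t (head e))) ^ 2 ≤ C * Real.exp (-a * t) :=
    (Finset.single_le_sum (f := fun e => σ t e / ℓ e * (ℓ e - (p t (tail e) - p t (head e))) ^ 2)
      (fun f _ => mul_nonneg (div_nonneg (hdyn.pos t ht f).le (hℓ f).le) (sq_nonneg _))
      (Finset.mem_univ e)).trans (hT t ht)
  have h2 : m * ε * (field tail head ℓ (p t) e - 1) ^ 2 ≤ C * Real.exp (-a * t) := by
    have h3 := (hℓ e).ne'
    calc m * ε * (field tail head ℓ (p t) e - 1) ^ 2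
        ≤ ℓ e * σ t e * (field tail head ℓ (p t) e - 1) ^ 2 := by
          have := hmℓ e trivial
          have := hℓ e
          gcongr
      _ = σ t e / ℓ e * (ℓ e - (p t (tail e) - p t (head e))) ^ 2 := by
          rw [field]
          field_simp
          ring
      _ ≤ _ := h1
  have h4 : Real.exp (-a * t) = Real.exp (-(a / 2) * t) ^ 2 := by
    rw [← Real.exp_nat_mul]
    congr 1
    push_cast
    ring
  have h5 : |field tail head ℓ (p t) e - 1|
      ≤ Real.sqrt (C / (m * ε)) * Real.exp (-(a / 2) * t) := by
    refine abs_le_of_sq_le_sq ?_ (by positivity)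
    rw [mul_pow, Real.sq_sqrt (by positivity), ← h4, div_mul_eq_mul_div,
      le_div_iff₀ (by positivity), mul_comm]
    exact h2
  exact h5.trans (by gcongr; linarith)
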